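/- Let m ≥ 1 and α₁,…,α_m ∈ ℝ satisfy liminf_{n→∞} n‖nα₁‖⋯‖nα_m‖ > 0 (n ranging over positive integers). Then there exists a constant C > 0 such that for all positive integers N₁,…,N_m, the set of points {n₁α₁ + ⋯ + n_mα_m mod 1 : nᵢ ∈ ℤ, |nᵢ| ≤ Nᵢ for all i} is C/(N₁⋯N_m)-dense in ℝ/ℤ, i.e. every point of ℝ/ℤ lies within distance C/(N₁⋯N_m) of this set. -/

import Mathlib

noncomputable section

open MeasureTheory Set Filter

/-- The distance from a real number to the nearest integer. -/
def distInt (x : ℝ) : ℝ := |x - round x|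

/-- The real vector in `ℝ^k` corresponding to an integer vector. -/
def intVec {k : ℕ} (n : Fin k → ℤ) : Fin k → ℝ := fun i => (n i : ℝ)

/-- The embedding of `ℝ^d` into `ℝ^k` as the span of the first `d` coordinates. -/
def emb (k d : ℕ) (x : Fin d → ℝ) : Fin k → ℝ :=
  fun i => if h : (i : ℕ) < d then x ⟨i, h⟩ else 0

/-- A `k` to `d` cut and project scheme: a totally irrational `d`-dimensional subspace
`E ⊆ ℝ^k`, the projection `proj = π` onto `E` along a complementary subspace `F_π`
(injective on `ℤ^k`), the projection `rho = ρ` onto `E` with respect to the decomposition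
`ℝ^k = E + F_ρ` where `F_ρ = {0} × ℝ^{k-d}`, a window `W ⊆ F_ρ`, and a point `s`
(a representative of a point of `ℝ^k/ℤ^k`). -/
structure CPS (k d : ℕ) where
  E : Submodule ℝ (Fin k → ℝ)
  rank_E : Module.finrank ℝ E = d
  /-- `E` is totally irrational: its image in `ℝ^k/ℤ^k` is dense,
  equivalently `E + ℤ^k` is dense in `ℝ^k`. -/
  totallyIrrational : Dense {x : Fin k → ℝ | ∃ e ∈ E, ∃ n : Fin k → ℤ, x = e + intVec n}
  /-- `π`, the projection onto `E` along a complementary subspace `F_π = ker proj`. -/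
  proj : (Fin k → ℝ) →ₗ[ℝ] (Fin k → ℝ)
  proj_mem : ∀ x, proj x ∈ E
  proj_id : ∀ x ∈ E, proj x = x
  /-- `π` is injective on `ℤ^k`. -/
  proj_inj : ∀ m n : Fin k → ℤ, proj (intVec m) = proj (intVec n) → m = n
  /-- `ρ`, the projection onto `E` with respect to the decomposition `ℝ^k = E + F_ρ`. -/
  rho : (Fin k → ℝ) →ₗ[ℝ] (Fin k → ℝ)
  rho_mem : ∀ x, rho x ∈ E
  /-- `x - ρ(x) ∈ F_ρ = {0} × ℝ^{k-d}`; in particular `ρ* = id - ρ` maps into `F_ρ`. -/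
  rho_decomp : ∀ (x : Fin k → ℝ) (i : Fin k), (i : ℕ) < d → x i - rho x i = 0
  /-- The window `W ⊆ F_ρ`. -/
  window : Set (Fin k → ℝ)
  window_sub : ∀ x ∈ window, ∀ i : Fin k, (i : ℕ) < d → x i = 0
  /-- A representative of the point `s ∈ ℝ^k/ℤ^k`. -/
  s : Fin k → ℝ

namespace CPS

variable {k d : ℕ} (𝒟 : CPS k d)

/-- `ρ* : ℝ^k → F_ρ`, the projection onto `F_ρ` along `E`. -/
def rhoStar (x : Fin k → ℝ) : Fin k → ℝ := x - 𝒟.rho x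

/-- The strip `S = W + E`. -/
def strip : Set (Fin k → ℝ) := {z | ∃ w ∈ 𝒟.window, ∃ e ∈ (𝒟.E : Set (Fin k → ℝ)), z = w + e}

/-- The cut and project set `Y = π(S ∩ (ℤ^k + s))`. -/
def Y : Set (Fin k → ℝ) :=
  𝒟.proj '' (𝒟.strip ∩ {z | ∃ n : Fin k → ℤ, z = intVec n + 𝒟.s})

/-- `s` is regular: `ℤ^k + s` does not meet the boundary of the strip. -/
def Regular : Prop := ∀ n : Fin k → ℤ, intVec n + 𝒟.s ∉ frontier 𝒟.strip

/-- `Y` is aperiodic: its group of periods is trivial. -/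
def Aperiodic : Prop := ∀ x ∈ (𝒟.E : Set (Fin k → ℝ)),
  {z | ∃ y ∈ 𝒟.Y, z = y + x} = 𝒟.Y → x = 0

/-- The window is the cubical window `{Σ_{i=d+1}^k t_i e_i : 0 ≤ t_i < 1}`. -/
def IsCubical : Prop :=
  𝒟.window = {x : Fin k → ℝ | ∀ i : Fin k,
    if (i : ℕ) < d then x i = 0 else 0 ≤ x i ∧ x i < 1}

/-- The window is the canonical window `ρ*([0,1]^k)`. -/
def IsCanonical : Prop :=
  𝒟.window = 𝒟.rhoStar '' {x : Fin k → ℝ | ∀ i, x i ∈ Icc (0 : ℝ) 1}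

/-- `Y` is a cubical cut and project set: totally irrational (a field of `CPS`),
regular, aperiodic, and formed with the cubical window. -/
def IsCubicalCPSet : Prop := 𝒟.IsCubical ∧ 𝒟.Regular ∧ 𝒟.Aperiodic

/-- `Y` is a canonical cut and project set. -/
def IsCanonicalCPSet : Prop := 𝒟.IsCanonical ∧ 𝒟.Regular ∧ 𝒟.Aperiodic

/-- For `y ∈ Y`, the (unique, by injectivity of `π` on `ℤ^k`) integer vector `ỹ`
with `ỹ + s ∈ S` and `π(ỹ + s) = y`. -/
def intRep (y : Fin k → ℝ) : Fin k → ℤ :=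
  Classical.epsilon fun n : Fin k → ℤ =>
    intVec n + 𝒟.s ∈ 𝒟.strip ∧ 𝒟.proj (intVec n + 𝒟.s) = y

/-- The patch of shape `Ω` at `y`: `P(y,Ω) = {y' ∈ Y : ρ(ỹ' - ỹ) ∈ ρ(Ω)}`,
where `Ω ⊆ ℝ^d` is viewed inside `⟨e₁,…,e_d⟩_ℝ ⊆ ℝ^k`. -/
def patch (Ω : Set (Fin d → ℝ)) (y : Fin k → ℝ) : Set (Fin k → ℝ) :=
  {y' | y' ∈ 𝒟.Y ∧
    𝒟.rho (intVec (𝒟.intRep y') - intVec (𝒟.intRep y)) ∈ 𝒟.rho '' (emb k d '' Ω)}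

/-- Two patches of shape `Ω` are equivalent if they agree up to the translation
taking one distinguished point to the other. -/
def PatchEquiv (Ω : Set (Fin d → ℝ)) (y₁ y₂ : Fin k → ℝ) : Prop :=
  𝒟.patch Ω y₁ = {z | ∃ w ∈ 𝒟.patch Ω y₂, z = w + (y₁ - y₂)}

/-- The pattern (equivalence class) of the patch of shape `Ω` at `y` occurs in the
region `R ⊆ E`: some point `y' ∈ Y ∩ R` has patch equivalent to that at `y`. -/
def OccursIn (Ω : Set (Fin d → ℝ)) (y : Fin k → ℝ) (R : Set (Fin k → ℝ)) : Prop :=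
  ∃ y' ∈ 𝒟.Y ∩ R, 𝒟.PatchEquiv Ω y' y

/-- `Y` is linearly repetitive with respect to a collection `𝒜` of shapes in `ℝ^d`:
there is `C > 0` such that for every `Ω ∈ 𝒜`, every pattern of shape `Ω` occurring in
`Y` occurs in every ball in `E` of volume `C·|Ω|` (balls in `E` being images under the
identification `ρ ∘ emb : ℝ^d ≅ E` of balls in `ℝ^d`). -/
def IsLR (𝒜 : Set (Set (Fin d → ℝ))) : Prop :=
  ∃ C > (0 : ℝ), ∀ Ω ∈ 𝒜, ∀ y ∈ 𝒟.Y, ∀ (x : Fin d → ℝ) (r : ℝ),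
    volume (Metric.closedBall x r) = ENNReal.ofReal C * volume Ω →
    𝒟.OccursIn Ω y (𝒟.rho '' (emb k d '' Metric.closedBall x r))

/-- `Y` is `LR_Ω` with respect to a collection `𝒜` of shapes in `ℝ^d`: there is `C > 0`
such that for every `Ω ∈ 𝒜`, every pattern of shape `Ω` occurring in `Y` occurs in every
translate of `C·Ω`. -/
def IsLROmega (𝒜 : Set (Set (Fin d → ℝ))) : Prop :=
  ∃ C > (0 : ℝ), ∀ Ω ∈ 𝒜, ∀ y ∈ 𝒟.Y, ∀ x : Fin d → ℝ,
    𝒟.OccursIn Ω y (𝒟.rho '' (emb k d '' {z | ∃ w ∈ Ω, z = x + C • w}))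

end CPS

/-- `ℛ_d`: aligned rectangles in `ℝ^d` with integer vertices and nonempty interior. -/
def RdCollection (d : ℕ) : Set (Set (Fin d → ℝ)) :=
  {Ω | ∃ a b : Fin d → ℤ, (∀ i, a i < b i) ∧
    Ω = {x : Fin d → ℝ | ∀ i, (a i : ℝ) ≤ x i ∧ x i ≤ (b i : ℝ)}}

/-- `𝒞_d`: convex polytopes in `ℝ^d` with vertices in `ℤ^d` and nonempty interior. -/
def CdCollection (d : ℕ) : Set (Set (Fin d → ℝ)) :=
  {Ω | (∃ V : Finset (Fin d → ℤ),
      Ω = convexHull ℝ ((fun n : Fin d → ℤ => intVec n) '' (V : Set (Fin d → ℤ)))) ∧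
    (interior Ω).Nonempty}

/-- Distance to the nearest integer is at most the distance to any integer. -/
lemma distInt_le (x : ℝ) (z : ℤ) : distInt x ≤ |x - z| := round_le x z

lemma distInt_nonneg (x : ℝ) : 0 ≤ distInt x := abs_nonneg _

lemma distInt_nat_mul (k : ℕ) (x : ℝ) : distInt (k * x) ≤ k * distInt x := by
  have h := distInt_le (k * x) (k * round x)
  refine h.trans (le_of_eq ?_)
  unfold distInt
  push_cast
  rw [← mul_sub, abs_mul, Nat.abs_cast]

/-- The liminf hypothesis gives a uniform lower bound for all positive `n`. -/
lemma step_zero (m : ℕ) (α : Fin m → ℝ)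
    (h : 0 < Filter.liminf
      (fun n : ℕ => (n : ℝ) * ∏ i, distInt ((n : ℝ) * α i)) Filter.atTop) :
    ∃ c > (0 : ℝ), ∀ n : ℕ, 1 ≤ n → c ≤ (n : ℝ) * ∏ i, distInt ((n : ℝ) * α i) := by
  have hb : Filter.IsBoundedUnder (· ≥ ·) Filter.atTop
      (fun n : ℕ => (n : ℝ) * ∏ i, distInt ((n : ℝ) * α i)) := by
    refine Filter.isBoundedUnder_of ⟨0, fun n => ?_⟩
    exact mul_nonneg (Nat.cast_nonneg n) (Finset.prod_nonneg fun i _ => distInt_nonneg _)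
  have h2 := Filter.eventually_lt_of_lt_liminf (half_lt_self h) hb
  set c₀ := Filter.liminf
      (fun n : ℕ => (n : ℝ) * ∏ i, distInt ((n : ℝ) * α i)) Filter.atTop / 2 with hc₀
  have hc₀pos : 0 < c₀ := half_pos h
  obtain ⟨a, ha⟩ := Filter.eventually_atTop.1 h2
  set k := a + 1 with hk
  have hkpos : (0 : ℝ) < k := by positivity
  refine ⟨c₀ / (k * (k : ℝ) ^ m), by positivity, fun n hn => ?_⟩
  have h3 := ha (k * n) (by nlinarith)
  rw [div_le_iff₀ (by positivity)]
  have h4 : ∏ i, distInt (((k * n : ℕ) : ℝ) * α i) ≤ ∏ i, ((k : ℝ) * distInt ((n : ℝ) * α i)) := by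
    refine Finset.prod_le_prod (fun i _ => distInt_nonneg _) fun i _ => ?_
    have := distInt_nat_mul k (n * α i)
    rwa [← mul_assoc, ← Nat.cast_mul] at this
  rw [Finset.prod_mul_distrib, Finset.prod_const, Finset.card_univ, Fintype.card_fin] at h4
  have h5 : ((k * n : ℕ) : ℝ) * ∏ i, distInt (((k * n : ℕ) : ℝ) * α i)
      ≤ ((k * n : ℕ) : ℝ) * ((k : ℝ) ^ m * ∏ i, distInt ((n : ℝ) * α i)) :=
    mul_le_mul_of_nonneg_left h4 (Nat.cast_nonneg _)
  have h6 := h3.le.trans h5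
  push_cast at h6
  linarith

/-- Equal cells force closeness. -/
lemma floor_close (b : ℕ) (hb : 0 < b) (u v : ℝ) (hu : 0 ≤ u) (hv : 0 ≤ v)
    (h : ⌊(b : ℝ) * u⌋₊ = ⌊(b : ℝ) * v⌋₊) : |u - v| < 1 / b := by
  have hb' : (0 : ℝ) < b := by exact_mod_cast hb
  have h1 := Nat.floor_le (mul_nonneg hb'.le hu)
  have h2 := Nat.lt_floor_add_one ((b : ℝ) * u)
  have h3 := Nat.floor_le (mul_nonneg hb'.le hv)
  have h4 := Nat.lt_floor_add_one ((b : ℝ) * v)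
  rw [h] at h1 h2
  rw [lt_div_iff₀ hb', ← abs_of_pos hb', ← abs_mul, abs_lt]
  constructor <;> nlinarith

lemma floor_mem (b : ℕ) (hb : 0 < b) (u : ℝ) : ⌊(b : ℝ) * Int.fract u⌋₊ < b := by
  have hb' : (0 : ℝ) < b := by exact_mod_cast hb
  rw [Nat.floor_lt (mul_nonneg hb'.le (Int.fract_nonneg u))]
  nlinarith [Int.fract_lt_one u]

/-- Homogeneous transference: from simultaneous approximation to linear forms. -/
lemma transfer_step (m : ℕ) (α : Fin m → ℝ) (T : ℕ) (hT : 0 < T) (n : Fin m → ℤ) (j : Fin m)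
    (hj : n j ≠ 0) (p : ℤ) :
    ∃ κ : ℕ, 1 ≤ κ ∧ (κ : ℝ) * ∏ i, distInt ((κ : ℝ) * α i) ≤
      (T : ℝ) ^ m * (∏ i, max 1 |(n i : ℝ)|) * |(∑ i, (n i : ℝ) * α i) - p| + m / T := by
  classical
  set θ : ℝ := (∑ i, (n i : ℝ) * α i) - p with hθ
  set N : Fin m → ℕ := fun i => max 1 (n i).natAbs with hN
  have hNpos : ∀ i, 0 < N i := fun i => by simp [hN]
  have hNj : N j = (n j).natAbs := by
    simp only [hN]; have := Int.natAbs_pos.2 hj; omega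
  have hNr : ∀ i, ((N i : ℕ) : ℝ) = max 1 |(n i : ℝ)| := fun i => by
    simp [hN, Nat.cast_natAbs]
  set b : Fin m → ℕ := fun i => if i = j then N i else T * N i with hb
  have hbpos : ∀ i, 0 < b i := fun i => by
    simp only [hb]; split_ifs
    · exact hNpos i
    · exact Nat.mul_pos hT (hNpos i)
  have hbj : b j = (n j).natAbs := by simp [hb, hNj]
  set K : ℕ := ∏ i, b i with hK
  set I : ℕ → ℤ := fun k => k * p - ∑ i, n i * ⌊(k : ℝ) * α i⌋ with hI
  have hmain : ∀ k : ℕ, ∑ i, (n i : ℝ) * Int.fract ((k : ℝ) * α i) = I k + k * θ := by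
    intro k
    simp only [hI, hθ, Int.fract]
    push_cast
    simp only [mul_sub, Finset.sum_sub_distrib, Finset.mul_sum]
    have : ∀ i, (n i : ℝ) * (k * α i) = k * (n i * α i) := fun i => by ring
    simp only [this]
    ring
  set f : ℕ → Fin m → ℕ := fun k i =>
    if i = j then (I k % n j).toNat else ⌊(b i : ℝ) * Int.fract ((k : ℝ) * α i)⌋₊ with hf
  have hmaps : ∀ k ∈ Finset.range (K + 1), f k ∈ Fintype.piFinset fun i => Finset.range (b i) := by
    intro k _
    rw [Fintype.mem_piFinset]
    intro i
    rw [Finset.mem_range]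
    simp only [hf]
    split_ifs with hij
    · subst hij
      rw [hbj]
      have h1 := Int.emod_nonneg (I k) hj
      have h2 := Int.emod_lt_abs (I k) hj
      rw [Int.abs_eq_natAbs] at h2
      omega
    · exact floor_mem _ (hbpos i) _
  have hcard : (Fintype.piFinset fun i => Finset.range (b i)).card < (Finset.range (K + 1)).card := by
    simp [hK]
  obtain ⟨k₁, hk₁, k₂, hk₂, hne, heq⟩ :=
    Finset.exists_ne_map_eq_of_card_lt_of_maps_to hcard hmaps
  wlog hlt : k₁ < k₂ generalizing k₁ k₂
  · exact this k₂ hk₂ k₁ hk₁ hne.symm heq.symm (by omega)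
  rw [Finset.mem_range] at hk₁ hk₂
  have hcast : ((k₂ - k₁ : ℕ) : ℝ) = k₂ - k₁ := by push_cast [hlt.le]; ring
  have hκK : ((k₂ - k₁ : ℕ) : ℝ) ≤ K := by exact_mod_cast (by omega : k₂ - k₁ ≤ K)
  refine ⟨k₂ - k₁, by omega, ?_⟩
  have hclose : ∀ i, i ≠ j →
      |Int.fract ((k₂ : ℝ) * α i) - Int.fract ((k₁ : ℝ) * α i)| < 1 / b i := by
    intro i hij
    have h1 := congrFun heq i
    simp only [hf, if_neg hij] at h1
    exact floor_close _ (hbpos i) _ _ (Int.fract_nonneg _) (Int.fract_nonneg _) h1.symm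
  have hdist : ∀ i, i ≠ j → distInt (((k₂ - k₁ : ℕ) : ℝ) * α i) ≤ 1 / b i := by
    intro i hij
    refine (distInt_le _ (⌊(k₂ : ℝ) * α i⌋ - ⌊(k₁ : ℝ) * α i⌋)).trans ?_
    refine le_trans (le_of_eq ?_) (hclose i hij).le
    rw [hcast]
    simp only [Int.fract]
    push_cast
    congr 1
    ring
  have hnj : (0 : ℝ) < |(n j : ℝ)| := abs_pos.2 (by exact_mod_cast hj)
  have hbjr : (b j : ℝ) = |(n j : ℝ)| := by rw [hbj, Nat.cast_natAbs]; simp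
  obtain ⟨s, hs⟩ : ∃ s : ℤ, I k₂ - I k₁ = n j * s := by
    have h1 := congrFun heq j
    simp only [hf, if_true] at h1
    have h2 := Int.emod_nonneg (I k₁) hj
    have h3 := Int.emod_nonneg (I k₂) hj
    have h4 : I k₁ % n j = I k₂ % n j := by omega
    exact Int.ModEq.dvd h4
  set d : Fin m → ℝ := fun i => Int.fract ((k₂ : ℝ) * α i) - Int.fract ((k₁ : ℝ) * α i) with hd
  have hsum : ∑ i, (n i : ℝ) * d i = n j * s + ((k₂ - k₁ : ℕ) : ℝ) * θ := by
    simp only [hd, mul_sub, Finset.sum_sub_distrib]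
    rw [hmain, hmain, hcast]
    have : (I k₂ : ℝ) - I k₁ = n j * s := by exact_mod_cast hs
    linarith
  rw [← Finset.add_sum_erase _ _ (Finset.mem_univ j)] at hsum
  have hrest : |∑ i ∈ Finset.univ.erase j, (n i : ℝ) * d i| ≤ m / T := by
    have hTr : (0 : ℝ) < T := by exact_mod_cast hT
    have h1 : ∀ i ∈ Finset.univ.erase j, |(n i : ℝ) * d i| ≤ 1 / T := by
      intro i hi
      have hij := Finset.ne_of_mem_erase hi
      have h2 := (hclose i hij).le
      have hbi : (b i : ℝ) = T * N i := by simp [hb, hij]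
      have hNi : (0 : ℝ) < N i := by exact_mod_cast hNpos i
      have h3 : |(n i : ℝ)| ≤ N i := by rw [hNr]; exact le_max_right _ _
      rw [abs_mul]
      calc |(n i : ℝ)| * |d i| ≤ N i * (1 / b i) := by
            apply mul_le_mul h3 h2 (abs_nonneg _) hNi.le
        _ = 1 / T := by rw [hbi]; field_simp
    refine (Finset.abs_sum_le_sum_abs _ _).trans ((Finset.sum_le_sum h1).trans ?_)
    rw [Finset.sum_const, nsmul_eq_mul, mul_one_div]
    gcongr
    exact_mod_cast (Finset.card_le_univ _).trans (by simp)
  set S : ℝ := K * |θ| + m / T with hS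
  have hdistj : distInt (((k₂ - k₁ : ℕ) : ℝ) * α j) ≤ 1 / b j * S := by
    have h0 := distInt_le (((k₂ - k₁ : ℕ) : ℝ) * α j) (⌊(k₂ : ℝ) * α j⌋ - ⌊(k₁ : ℝ) * α j⌋ + s)
    have h1 : ((k₂ - k₁ : ℕ) : ℝ) * α j
        - ((⌊(k₂ : ℝ) * α j⌋ - ⌊(k₁ : ℝ) * α j⌋ + s : ℤ) : ℝ) = d j - s := by
      rw [hcast]
      simp only [hd, Int.fract]
      push_cast
      ring
    rw [h1] at h0
    refine h0.trans ?_
    rw [hbjr, one_div, ← div_eq_inv_mul, le_div_iff₀ hnj, mul_comm, ← abs_mul]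
    have h2 : (n j : ℝ) * (d j - s) = ((k₂ - k₁ : ℕ) : ℝ) * θ
        - ∑ i ∈ Finset.univ.erase j, (n i : ℝ) * d i := by linarith
    rw [h2]
    refine (abs_sub _ _).trans (add_le_add ?_ hrest)
    rw [abs_mul, Nat.abs_cast]
    gcongr
  have hS0 : 0 ≤ S := by positivity
  have hprod : ∏ i, distInt (((k₂ - k₁ : ℕ) : ℝ) * α i) ≤ (∏ i, (1 / (b i : ℝ))) * S := by
    rw [← Finset.mul_prod_erase _ _ (Finset.mem_univ j),
      ← Finset.mul_prod_erase _ (fun i => 1 / (b i : ℝ)) (Finset.mem_univ j), mul_right_comm]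
    refine mul_le_mul hdistj ?_ (Finset.prod_nonneg fun i _ => distInt_nonneg _) (by positivity)
    exact Finset.prod_le_prod (fun i _ => distInt_nonneg _)
      fun i hi => hdist i (Finset.ne_of_mem_erase hi)
  have hKr : (K : ℝ) = ∏ i, (b i : ℝ) := by simp [hK]
  have hKpos : (0 : ℝ) < K := by
    rw [hKr]; exact Finset.prod_pos fun i _ => by exact_mod_cast hbpos i
  have hfin : ((k₂ - k₁ : ℕ) : ℝ) * ∏ i, distInt (((k₂ - k₁ : ℕ) : ℝ) * α i) ≤ S := by
    refine (mul_le_mul hκK hprod (Finset.prod_nonneg fun i _ => distInt_nonneg _) hKpos.le).trans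
      (le_of_eq ?_)
    rw [Finset.prod_div_distrib, Finset.prod_const_one, ← hKr]
    field_simp
  refine hfin.trans ?_
  rw [hS]
  gcongr
  calc (K : ℝ) = ∏ i, (b i : ℝ) := hKr
    _ ≤ ∏ i, ((T : ℝ) * max 1 |(n i : ℝ)|) := by
      refine Finset.prod_le_prod (fun i _ => by positivity) fun i _ => ?_
      rw [← hNr]
      have : b i ≤ T * N i := by
        simp only [hb]; split_ifs
        · exact Nat.le_mul_of_pos_left _ hT
        · exact le_rfl
      exact_mod_cast this
    _ = _ := by
      rw [Finset.prod_mul_distrib, Finset.prod_const, Finset.card_univ, Fintype.card_fin]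

lemma step_one (m : ℕ) (α : Fin m → ℝ) (c : ℝ) (hc : 0 < c)
    (h : ∀ n : ℕ, 1 ≤ n → c ≤ (n : ℝ) * ∏ i, distInt ((n : ℝ) * α i)) :
    ∃ ε > (0 : ℝ), ∀ n : Fin m → ℤ, n ≠ 0 → ∀ p : ℤ,
      ε ≤ (∏ i, max 1 |(n i : ℝ)|) * |(∑ i, (n i : ℝ) * α i) - p| := by
  obtain ⟨T, hT⟩ := exists_nat_gt (2 * m / c)
  have hTr : (0 : ℝ) < T := lt_of_le_of_lt (by positivity) hT
  have hT0 : 0 < T := by exact_mod_cast hTr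
  refine ⟨c / 2 / (T : ℝ) ^ m, by positivity, fun n hn p => ?_⟩
  obtain ⟨j, hj⟩ := Function.ne_iff.1 hn
  obtain ⟨κ, hκ, hle⟩ := transfer_step m α T hT0 n j hj p
  have h1 := (h κ hκ).trans hle
  have h2 : (m : ℝ) / T ≤ c / 2 := by
    rw [div_lt_iff₀ hc] at hT
    rw [div_le_iff₀ hTr]
    linarith
  rw [div_le_iff₀ (by positivity)]
  linarith

/-- If `m ≥ 1` and `liminf_{n→∞} n‖nα₁‖⋯‖nα_m‖ > 0`, then there is
`C > 0` such that for all positive integers `N₁,…,N_m`, the set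
`{n₁α₁ + ⋯ + n_mα_m mod 1 : |nᵢ| ≤ Nᵢ}` is `C/(N₁⋯N_m)`-dense in `ℝ/ℤ`. -/
theorem liminf_pos_implies_inhomogeneous_dense (m : ℕ) (hm : 1 ≤ m) (α : Fin m → ℝ)
    (h : 0 < Filter.liminf
      (fun n : ℕ => (n : ℝ) * ∏ i, distInt ((n : ℝ) * α i)) Filter.atTop) :
    ∃ C > (0 : ℝ), ∀ N : Fin m → ℕ, (∀ i, 0 < N i) → ∀ x : ℝ,
      ∃ n : Fin m → ℤ, (∀ i, |n i| ≤ (N i : ℤ)) ∧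
        distInt ((∑ i, (n i : ℝ) * α i) - x) ≤ C / ∏ i, (N i : ℝ) := by
  classical
  obtain ⟨c, hc, hc'⟩ := step_zero m α h
  obtain ⟨ε, hε, hsep⟩ := step_one m α c hc hc'
  obtain ⟨J, hJ⟩ := exists_nat_gt (1 / ε)
  set D : ℕ := J.factorial with hD
  have hDpos : 0 < D := Nat.factorial_pos J
  have hDr : (0 : ℝ) < D := by exact_mod_cast hDpos
  refine ⟨D * ε * (D : ℝ) ^ m, by positivity, fun N hN x => ?_⟩
  set M : Fin m → ℕ := fun i => N i / D with hM
  set Q : ℕ := ∏ i, (M i + 1) with hQ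
  have hQpos : 0 < Q := Finset.prod_pos fun i _ => Nat.succ_pos _
  have hQr : (0 : ℝ) < Q := by exact_mod_cast hQpos
  set B : ℕ := ⌊(Q : ℝ) / ε⌋₊ + 1 with hB
  have hBpos : 0 < B := Nat.succ_pos _
  have hBr : (0 : ℝ) < B := by exact_mod_cast hBpos
  have hBgt : (Q : ℝ) / ε < B := by rw [hB]; push_cast; exact Nat.lt_floor_add_one _
  have hBle : (B : ℝ) ≤ Q / ε + 1 := by
    rw [hB]; push_cast; gcongr; exact Nat.floor_le (by positivity)
  have hBinv : 1 / (B : ℝ) < ε / Q := by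
    rw [div_lt_iff₀ hε] at hBgt
    rw [div_lt_div_iff₀ hBr hQr]
    linarith
  set g : ℕ × (Fin m → ℕ) → ℝ := fun w => w.1 * (x / D) + ∑ i, (w.2 i : ℝ) * α i with hg
  set A := Finset.range (J + 1) ×ˢ Fintype.piFinset fun i => Finset.range (M i + 1) with hA
  have hmaps : ∀ w ∈ A, ⌊(B : ℝ) * Int.fract (g w)⌋₊ ∈ Finset.range B := fun w _ =>
    Finset.mem_range.2 (floor_mem B hBpos _)
  have hcard : (Finset.range B).card < A.card := by
    rw [hA, Finset.card_product, Fintype.card_piFinset]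
    simp only [Finset.card_range]
    rw [← hQ]
    have hQ1 : (1 : ℝ) ≤ Q := by exact_mod_cast hQpos
    have : (B : ℝ) < (J + 1) * Q := by
      calc (B : ℝ) ≤ Q / ε + 1 := hBle
        _ = 1 / ε * Q + 1 := by ring
        _ < J * Q + Q := by nlinarith
        _ = _ := by ring
    exact_mod_cast this
  obtain ⟨w₁, hw₁, w₂, hw₂, hne, heq⟩ :=
    Finset.exists_ne_map_eq_of_card_lt_of_maps_to hcard hmaps
  wlog hle : w₁.1 ≤ w₂.1 generalizing w₁ w₂
  · exact this w₂ hw₂ w₁ hw₁ hne.symm heq.symm (by omega)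
  obtain ⟨y₁, a₁⟩ := w₁
  obtain ⟨y₂, a₂⟩ := w₂
  simp only [hA, Finset.mem_product, Finset.mem_range, Fintype.mem_piFinset] at hw₁ hw₂
  obtain ⟨hy₁, ha₁⟩ := hw₁
  obtain ⟨hy₂, ha₂⟩ := hw₂
  simp only at hle
  have hcl := floor_close B hBpos _ _ (Int.fract_nonneg _) (Int.fract_nonneg _) heq
  set p : ℤ := ⌊g (y₁, a₁)⌋ - ⌊g (y₂, a₂)⌋ with hp
  set e : Fin m → ℤ := fun i => (a₁ i : ℤ) - a₂ i with he
  have hkey : |(∑ i, (e i : ℝ) * α i) - ((y₂ - y₁ : ℕ) : ℝ) * (x / D) - p| < 1 / B := by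
    convert hcl using 2
    simp only [hp, he, Int.fract, hg]
    push_cast [hle]
    simp only [sub_mul, Finset.sum_sub_distrib]
    ring
  have hebd : ∀ i, |e i| ≤ M i := by
    intro i
    have h1 := ha₁ i
    have h2 := ha₂ i
    rw [abs_le]
    simp only [he]
    omega
  clear_value p e
  rcases hle.eq_or_lt with hyy | hlt
  · exfalso
    subst hyy
    have he0 : e ≠ 0 := by
      intro h0
      apply hne
      congr 1
      funext i
      have := congrFun h0 i
      simp only [he, Pi.zero_apply] at this
      omega
    have h1 := hsep e he0 p
    simp only [Nat.sub_self, Nat.cast_zero, zero_mul, sub_zero] at hkey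
    have h2 : ∏ i, max 1 |(e i : ℝ)| ≤ Q := by
      rw [hQ]; push_cast
      refine Finset.prod_le_prod (fun i _ => by positivity) fun i _ => ?_
      have h3 : |(e i : ℝ)| ≤ M i := by exact_mod_cast hebd i
      have h4 : (0 : ℝ) ≤ M i := Nat.cast_nonneg _
      exact max_le (by linarith) (by linarith)
    have h3 := h1.trans (mul_le_mul_of_nonneg_right h2 (abs_nonneg _))
    have h4 := mul_lt_mul_of_pos_left (hkey.trans hBinv) hQr
    rw [mul_div_cancel₀ _ hQr.ne'] at h4
    linarith
  · obtain ⟨z, hz⟩ : (y₂ - y₁) ∣ D := Nat.dvd_factorial (by omega) (by omega)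
    have hzD : z ≤ D := by
      rw [hz]; exact Nat.le_mul_of_pos_left _ (by omega)
    have hzr : (D : ℝ) = ((y₂ - y₁ : ℕ) : ℝ) * z := by exact_mod_cast hz
    refine ⟨fun i => z * e i, fun i => ?_, ?_⟩
    · rw [abs_mul, Nat.abs_cast]
      have h1 : (z : ℤ) * |e i| ≤ D * M i :=
        mul_le_mul (by exact_mod_cast hzD) (hebd i) (abs_nonneg _) (by positivity)
      refine h1.trans ?_
      exact_mod_cast Nat.mul_div_le (N i) D
    · refine (distInt_le _ (z * p)).trans ?_
      have h1 : (∑ i, ((z * e i : ℤ) : ℝ) * α i) - x - ((z * p : ℤ) : ℝ)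
          = z * ((∑ i, (e i : ℝ) * α i) - ((y₂ - y₁ : ℕ) : ℝ) * (x / D) - p) := by
        have h2 : (z : ℝ) * (((y₂ - y₁ : ℕ) : ℝ) * (x / D)) = x := by
          rw [← mul_assoc, mul_comm (z : ℝ), ← hzr]; field_simp
        rw [mul_sub, mul_sub, h2, Finset.mul_sum]
        push_cast
        simp only [mul_assoc]
      rw [h1, abs_mul, Nat.abs_cast]
      have hPpos : (0 : ℝ) < ∏ i, (N i : ℝ) :=
        Finset.prod_pos fun i _ => by exact_mod_cast hN i
      have hPQ : ∏ i, (N i : ℝ) ≤ (D : ℝ) ^ m * Q := by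
        have h3 : ∏ i, (N i : ℝ) ≤ ∏ i, ((D : ℝ) * (M i + 1)) := by
          refine Finset.prod_le_prod (fun i _ => by positivity) fun i _ => ?_
          have := (Nat.lt_mul_div_succ (N i) hDpos).le
          exact_mod_cast this
        rw [Finset.prod_mul_distrib, Finset.prod_const, Finset.card_univ,
          Fintype.card_fin] at h3
        rw [hQ]; push_cast; exact h3
      calc (z : ℝ) * _ ≤ D * (ε / Q) := by
            apply mul_le_mul (by exact_mod_cast hzD) (hkey.trans hBinv).le (abs_nonneg _) hDr.le
        _ ≤ _ := by
            rw [← mul_div_assoc, div_le_div_iff₀ hQr hPpos]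
            calc D * ε * ∏ i, (N i : ℝ) ≤ D * ε * ((D : ℝ) ^ m * Q) := by gcongr
              _ = _ := by ring
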